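/- arXiv:2010.03913 — 2 statements merged into one kernel-verified Lean document; each statement's English description precedes it below -/
import Mathlib

section
/- Let G be a group, X a set, and let F and F' be free G-sets each admitting a basis indexed by X. Let Fr(F) and Fr(F') denote the sets of bases indexed by X, each equipped with the wreath product action ((g̃, σ) • f)(x) = g̃(x) • f(σ⁻¹(x)) for g̃ : X → G and σ a bijection of X. Then for every map β : Fr(F) → Fr(F') that is equivariant for these wreath product actions, there exists a unique G-equivariant map α : F → F' such that β(f) = α ∘ f for all f ∈ Fr(F). -/
/-- Every map between frame spaces of free G-sets (with bases indexed by the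
same set `X`) that is equivariant for the wreath product actions is induced by
a unique G-equivariant map `α : F → F'` via postcomposition. -/
theorem frame_map_induced_by_unique_equivariant_map {G F F' X : Type}
    [Group G] [MulAction G F] [MulAction G F']
    (hfreeF : ∀ (g : G) (a : F), g • a = a → g = 1)
    (hfreeF' : ∀ (g : G) (a : F'), g • a = a → g = 1)
    (hF : ∃ f : X → F, Function.Bijective (fun p : G × X => p.1 • f p.2))
    (hF' : ∃ f : X → F', Function.Bijective (fun p : G × X => p.1 • f p.2))
    (β : {f : X → F // Function.Bijective (fun p : G × X => p.1 • f p.2)} →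
         {f : X → F' // Function.Bijective (fun p : G × X => p.1 • f p.2)})
    (hβ : ∀ (f : {f : X → F // Function.Bijective (fun p : G × X => p.1 • f p.2)})
        (gs : X → G) (σ : Equiv.Perm X)
        (h : Function.Bijective (fun p : G × X => p.1 • (gs p.2 • f.1 (σ⁻¹ p.2)))),
        (β ⟨fun x => gs x • f.1 (σ⁻¹ x), h⟩).1 =
          fun x => gs x • (β f).1 (σ⁻¹ x)) :
    ∃! α : F → F', (∀ (g : G) (a : F), α (g • a) = g • α a) ∧
        ∀ f, (β f).1 = α ∘ f.1 := by
  obtain ⟨f0, h0⟩ := hF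
  let e := Equiv.ofBijective _ h0
  have he : ∀ g x, e.symm (g • f0 x) = (g, x) := fun g x => e.symm_apply_apply (g, x)
  have he' : ∀ a, (e.symm a).1 • f0 (e.symm a).2 = a := fun a => e.apply_symm_apply a
  refine ⟨fun a => (e.symm a).1 • (β ⟨f0, h0⟩).1 (e.symm a).2, ⟨?_, ?_⟩, ?_⟩
  · intro g a
    obtain ⟨⟨k, x⟩, rfl⟩ := h0.2 a
    simp only [smul_smul, he]
  · rintro ⟨f, hf⟩
    have hτ : Function.Bijective (fun x => (e.symm (f x)).2) := by
      constructor
      · intro x y hxy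
        simp only at hxy
        have h1 : (e.symm (f x)).1⁻¹ • f x = (e.symm (f y)).1⁻¹ • f y := by
          rw [inv_smul_eq_iff.2 (he' (f x)).symm, inv_smul_eq_iff.2 (he' (f y)).symm, hxy]
        have := @hf.1 (_, x) (_, y) h1
        exact (Prod.ext_iff.1 this).2
      · intro y
        obtain ⟨⟨g, x⟩, hx⟩ := hf.2 (f0 y)
        simp only at hx
        refine ⟨x, ?_⟩
        rw [← he' (f x), smul_smul, ← one_smul G (f0 y)] at hx
        have := @h0.1 (_, _) (_, y) hx
        exact (Prod.ext_iff.1 this).2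
    have hfe : (fun x => (e.symm (f x)).1 • f0 ((Equiv.ofBijective _ hτ)⁻¹⁻¹ x)) = f := by
      funext x
      rw [inv_inv]
      exact he' (f x)
    have key := hβ ⟨f0, h0⟩ (fun x => (e.symm (f x)).1) (Equiv.ofBijective _ hτ)⁻¹
      (by
        have h2 := hf
        rw [← hfe] at h2
        exact h2)
    have h3 : ∀ (f' : X → F) (h' : Function.Bijective (fun p : G × X => p.1 • f' p.2)),
        f' = f → β ⟨f', h'⟩ = β ⟨f, hf⟩ := by
      rintro _ _ rfl
      rfl
    rw [h3 _ _ hfe] at key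
    rw [key]
    funext x
    simp only [inv_inv]
    rfl
  · rintro α ⟨h1, h2⟩
    funext a
    obtain ⟨⟨k, x⟩, rfl⟩ := h0.2 a
    simp only [he, h1, h2 ⟨f0, h0⟩, Function.comp]
end

section
/- Let n ≥ 3 and let π : B → M be a fiber bundle of topological spaces with discrete model fiber Fin n (an n-sheeted covering given by local trivializations). Suppose the symmetric group S_n = Sym(Fin n) acts on B such that each σ ∈ S_n acts by a homeomorphism of B, the action preserves fibers (π(σ • b) = π(b) for all σ, b), and for every m ∈ M the induced action of S_n on the fiber π⁻¹(m) is faithful. Then the bundle is trivial: there is a homeomorphism Φ : B → M × Fin n with pr_M ∘ Φ = π. -/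
/-- An `n`-sheeted covering (`n ≥ 3`), i.e. a fiber bundle with discrete model
fiber `Fin n`, carrying a fiber-preserving action of `Sym(Fin n)` by
homeomorphisms that is faithful on every fiber, is a trivial bundle. -/
theorem faithful_Sn_action_implies_trivial_bundle {B M : Type}
    [TopologicalSpace B] [TopologicalSpace M] (n : ℕ) (hn : 3 ≤ n)
    (π : B → M) (hπcont : Continuous π) (hπsurj : Function.Surjective π)
    (htriv : ∀ m : M, ∃ U : Set M, m ∈ U ∧ IsOpen U ∧
      ∃ φ : (U × Fin n) ≃ₜ (π ⁻¹' U),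
        ∀ p : U × Fin n, π (φ p : B) = (p.1 : M))
    [MulAction (Equiv.Perm (Fin n)) B]
    (hcont : ∀ σ : Equiv.Perm (Fin n), Continuous fun b : B => σ • b)
    (hfib : ∀ (σ : Equiv.Perm (Fin n)) (b : B), π (σ • b) = π b)
    (hfaithful : ∀ (m : M) (σ : Equiv.Perm (Fin n)),
        (∀ b : B, π b = m → σ • b = b) → σ = 1) :
    ∃ Φ : B ≃ₜ M × Fin n, ∀ b : B, (Φ b).1 = π b := by
  classical
  have hn0 : NeZero n := ⟨by omega⟩
  have hev : ∀ m, IsEvenlyCovered π m (Fin n) := by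
    intro m
    obtain ⟨U, hm, hU, φ, hφ⟩ := htriv m
    refine ⟨inferInstance, U, hm, hU, hU.preimage hπcont, φ.symm, fun x => ?_⟩
    have := hφ (φ.symm x)
    simpa using this.symm
  have hcov : IsCoveringMap π := fun m => (hev m).to_isEvenlyCovered_preimage
  have hcard : ∀ m, Nat.card (π ⁻¹' {m}) = n := by
    intro m
    rw [← Nat.card_congr (hev m).fiberHomeomorph.toEquiv]; simp
  have hfin : ∀ m, Finite (π ⁻¹' {m}) := fun m =>
    Nat.finite_of_card_ne_zero (by rw [hcard]; omega)
  let S : B → Subgroup (Equiv.Perm (Fin n)) := fun b => MulAction.stabilizer _ b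
  have hSinj : ∀ b b', π b = π b' → S b = S b' → b = b' := by
    intro b b' hbb hS
    by_contra hne
    let m := π b
    have := hfin m
    let f : Equiv.Perm (Fin n) → Equiv.Perm (π ⁻¹' {m}) := fun σ =>
      { toFun := fun x => ⟨σ • x.1, by
          have := x.2
          simp only [Set.mem_preimage, Set.mem_singleton_iff] at this ⊢
          rw [hfib, this]⟩
        invFun := fun x => ⟨σ⁻¹ • x.1, by
          have := x.2
          simp only [Set.mem_preimage, Set.mem_singleton_iff] at this ⊢
          rw [hfib, this]⟩
        left_inv := fun x => by simp
        right_inv := fun x => by simp }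
    have hfi : Function.Injective f := by
      intro σ τ h
      have : τ⁻¹ * σ = 1 := by
        apply hfaithful m
        intro c hc
        have h1 := congrArg Subtype.val (Equiv.congr_fun h ⟨c, hc⟩)
        have h2 : σ • c = τ • c := h1
        rw [mul_smul, h2, inv_smul_smul]
      exact (inv_mul_eq_one.1 this).symm
    have hfb : Function.Bijective f := by
      refine (Nat.bijective_iff_injective_and_card f).2 ⟨hfi, ?_⟩
      rw [Nat.card_perm, Nat.card_perm, hcard]; simp
    obtain ⟨c, hcb, hcb'⟩ : ∃ c : π ⁻¹' {m}, c ≠ ⟨b, rfl⟩ ∧ c ≠ ⟨b', hbb.symm⟩ := by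
      by_contra! hcon
      have : (Set.univ : Set (π ⁻¹' {m})) ⊆ {⟨b, rfl⟩, ⟨b', hbb.symm⟩} := by
        intro c _
        by_cases h : c = ⟨b, rfl⟩
        · simp [h]
        · right; exact hcon c h
      have h1 := Set.ncard_le_ncard this
      have h2 := Set.ncard_insert_le (⟨b, rfl⟩ : π ⁻¹' {m}) {⟨b', hbb.symm⟩}
      rw [Set.ncard_univ, hcard] at h1
      rw [Set.ncard_singleton] at h2
      omega
    obtain ⟨σ, hσ⟩ := hfb.2 (Equiv.swap ⟨b', hbb.symm⟩ c)
    have h1 : σ • b = b := by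
      have := congrArg Subtype.val (Equiv.congr_fun hσ ⟨b, rfl⟩)
      rw [Equiv.swap_apply_of_ne_of_ne (fun h => hne (Subtype.ext_iff.1 h)) hcb.symm] at this
      exact this
    have h2 : σ • b' = c := by
      have := congrArg Subtype.val (Equiv.congr_fun hσ ⟨b', hbb.symm⟩)
      rw [Equiv.swap_apply_left] at this
      exact this
    have h3 : σ ∈ S b' := by
      rw [← hS]; exact h1
    have h4 : σ • b' = b' := h3
    exact hcb' (Subtype.ext (h2.symm.trans h4))
  have hSloc : IsLocallyConstant S := by
    rw [IsLocallyConstant.iff_eventually_eq]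
    intro b
    have key : ∀ σ : Equiv.Perm (Fin n), ∀ᶠ c in nhds b, (σ • c = c ↔ σ • b = b) := by
      intro σ
      have ho : IsOpen {c : B | σ • c = c} :=
        hcov.isLocalHomeomorph.isLocallyInjective.isOpen_eqLocus (hcont σ) continuous_id
          (funext fun c => hfib σ c)
      have hc : IsClosed {c : B | σ • c = c} :=
        hcov.isSeparatedMap.isClosed_eqLocus (hcont σ) continuous_id
          (funext fun c => hfib σ c)
      by_cases h : σ • b = b
      · filter_upwards [ho.mem_nhds h] with c hc
        exact iff_of_true hc h
      · filter_upwards [hc.isOpen_compl.mem_nhds h] with c hc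
        exact iff_of_false hc h
    filter_upwards [Filter.eventually_all.2 key] with c hc
    ext σ
    exact hc σ
  let T : M → Set (Subgroup (Equiv.Perm (Fin n))) := fun m => S '' (π ⁻¹' {m})
  have hTcard : ∀ m, (T m).ncard = n := by
    intro m
    have h : Set.InjOn S (π ⁻¹' {m}) := by
      intro b hb c hc hbc
      exact hSinj b c (Eq.trans hb (Eq.symm hc)) hbc
    rw [h.ncard_image, ← hcard m]
    rfl
  have hTloc : IsLocallyConstant T := by
    rw [IsLocallyConstant.iff_eventually_eq]
    intro m
    have key : ∀ H : T m, ∀ᶠ u in nhds m, H.1 ∈ T u := by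
      rintro ⟨H, b, hb, rfl⟩
      have ho := hcov.isLocalHomeomorph.isOpenMap _ (hSloc.isOpen_fiber (S b))
      filter_upwards [ho.mem_nhds ⟨b, rfl, hb⟩] with u hu
      obtain ⟨c, hc, rfl⟩ := hu
      exact ⟨c, rfl, hc⟩
    filter_upwards [Filter.eventually_all.2 key] with u hu
    exact (Set.eq_of_subset_of_ncard_le (fun H hH => hu ⟨H, hH⟩)
      (by rw [hTcard, hTcard])).symm
  have hex : ∀ A : Set (Subgroup (Equiv.Perm (Fin n))),
      ∃ e : Subgroup (Equiv.Perm (Fin n)) → Fin n, A.ncard = n → Set.BijOn e A Set.univ := by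
    intro A
    by_cases hA : A.ncard = n
    · have e : A ≃ Fin n := Finite.equivFinOfCardEq hA
      refine ⟨fun H => if h : H ∈ A then e ⟨H, h⟩ else 0, fun _ => ⟨fun _ _ => trivial, ?_, ?_⟩⟩
      · intro H hH K hK h
        simp only [hH, hK, dif_pos] at h
        exact congrArg Subtype.val (e.injective h)
      · intro i _
        refine ⟨(e.symm i).1, (e.symm i).2, ?_⟩
        simp
    · exact ⟨fun _ => 0, fun h => absurd h hA⟩
  choose e he using hex
  let Φ : B → M × Fin n := fun b => (π b, e (T (π b)) (S b))
  have hΦc : Continuous Φ := by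
    refine hπcont.prodMk ?_
    exact ((hTloc.comp_continuous hπcont).comp₂ hSloc e).continuous
  have hfst : IsCoveringMap (Prod.fst : M × Fin n → M) := by
    intro m
    refine IsEvenlyCovered.to_isEvenlyCovered_preimage (I := Fin n) ?_
    refine ⟨inferInstance, Set.univ, trivial, isOpen_univ, isOpen_univ, ?_⟩
    exact ⟨(Homeomorph.Set.univ _).trans
      ((Homeomorph.Set.univ M).symm.prodCongr (Homeomorph.refl _)), fun x => rfl⟩
  have hΦl : IsLocalHomeomorph Φ :=
    IsLocalHomeomorph.of_comp (g := Prod.fst) hcov.isLocalHomeomorph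
      hfst.isLocalHomeomorph hΦc
  have hΦb : Function.Bijective Φ := by
    constructor
    · intro b c h
      have h1 : π b = π c := congrArg Prod.fst h
      have h2 : e (T (π b)) (S b) = e (T (π c)) (S c) := congrArg Prod.snd h
      rw [← h1] at h2
      exact hSinj b c h1 ((he _ (hTcard _)).injOn ⟨b, rfl, rfl⟩ ⟨c, h1.symm, rfl⟩ h2)
    · rintro ⟨m, i⟩
      obtain ⟨H, ⟨b, hb, rfl⟩, hi⟩ := (he _ (hTcard m)).surjOn (Set.mem_univ i)
      have hb' : π b = m := hb
      refine ⟨b, ?_⟩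
      subst hb'
      exact Prod.ext rfl hi
  exact ⟨hΦl.toHomeomorphOfBijective hΦb, fun b => rfl⟩
end
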